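/- arXiv:2206.13764 — 2 statements merged into one kernel-verified Lean document; each statement's English description precedes it below -/
import Mathlib

section
/- Let h₁,…,h_k and y be random variables on a probability space, each taking values in a nonempty finite type, and let α, β be real numbers. Assume that the family (h₁,…,h_k) is mutually independent and also conditionally mutually independent given y. Then the three-property objective of the paper decomposes exactly as: I((h₁,…,h_k); y) − α·Σ_{i=1}^{k} H(hᵢ|y) − β·Σ_{i≠j} I(hᵢ;hⱼ;y) = (1+α)·Σ_{i=1}^{k} I(hᵢ; y) − α·Σ_{i=1}^{k} H(hᵢ). In particular, under these independence hypotheses the term Σ_{i≠j} I(hᵢ;hⱼ;y) vanishes, and maximizing Σᵢ I(hᵢ;y) for fixed marginal entropies H(hᵢ) maximizes the three-property objective. -/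
open MeasureTheory Finset

/-- `pr P A a` is the probability `P(A = a)` (as a real number). -/
noncomputable def pr {Ω : Type*} [MeasurableSpace Ω] (P : Measure Ω)
    {α : Type*} (A : Ω → α) (a : α) : ℝ :=
  (P {ω | A ω = a}).toReal

/-- Shannon entropy `H(A) = ∑ₐ −P(A=a)·log P(A=a)` (natural log, `0·log 0 = 0`). -/
noncomputable def ent {Ω : Type*} [MeasurableSpace Ω] (P : Measure Ω)
    {α : Type*} [Fintype α] (A : Ω → α) : ℝ :=
  ∑ a, Real.negMulLog (pr P A a)

/-- Mutual information `I(A;B) = H(A) + H(B) − H(A,B)`. -/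
noncomputable def mi {Ω : Type*} [MeasurableSpace Ω] (P : Measure Ω)
    {α β : Type*} [Fintype α] [Fintype β] (A : Ω → α) (B : Ω → β) : ℝ :=
  ent P A + ent P B - ent P (fun ω => (A ω, B ω))

/-- Conditional entropy `H(A|Y) = H(A,Y) − H(Y)`. -/
noncomputable def condEnt {Ω : Type*} [MeasurableSpace Ω] (P : Measure Ω)
    {α γ : Type*} [Fintype α] [Fintype γ] (A : Ω → α) (Y : Ω → γ) : ℝ :=
  ent P (fun ω => (A ω, Y ω)) - ent P Y

/-- Conditional mutual information `I(A;B|Y) = H(A|Y) + H(B|Y) − H((A,B)|Y)`. -/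
noncomputable def cmi {Ω : Type*} [MeasurableSpace Ω] (P : Measure Ω)
    {α β γ : Type*} [Fintype α] [Fintype β] [Fintype γ]
    (A : Ω → α) (B : Ω → β) (Y : Ω → γ) : ℝ :=
  condEnt P A Y + condEnt P B Y - condEnt P (fun ω => (A ω, B ω)) Y

/-- Interaction information `I(A;B;Y) = I(A;B) − I(A;B|Y)`. -/
noncomputable def interInfo {Ω : Type*} [MeasurableSpace Ω] (P : Measure Ω)
    {α β γ : Type*} [Fintype α] [Fintype β] [Fintype γ]
    (A : Ω → α) (B : Ω → β) (Y : Ω → γ) : ℝ :=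
  mi P A B - cmi P A B Y

open ProbabilityTheory in
theorem pr_cond {Ω : Type*} [MeasurableSpace Ω] (P : Measure Ω)
    {α γ : Type*} [MeasurableSpace γ] [MeasurableSingletonClass γ]
    (A : Ω → α) {Y : Ω → γ} (hY : Measurable Y) (a : α) (b : γ) :
    pr (P[|Y ⁻¹' {b}]) A a = pr P (fun ω => (A ω, Y ω)) (a, b) / pr P Y b := by
  have hset : Y ⁻¹' {b} ∩ {ω | A ω = a} = {ω | (A ω, Y ω) = (a, b)} := by
    ext ω
    simp [and_comm]
  rw [pr, cond_apply (hY (measurableSet_singleton b)), hset, ENNReal.toReal_mul,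
    ENNReal.toReal_inv, mul_comm, ← div_eq_mul_inv]
  rfl

theorem sum_pr {Ω : Type*} [MeasurableSpace Ω] (P : Measure Ω) [IsProbabilityMeasure P]
    {α : Type*} [Fintype α] [MeasurableSpace α] [MeasurableSingletonClass α]
    {A : Ω → α} (hA : Measurable A) : ∑ a, pr P A a = 1 := by
  have := sum_measureReal_preimage_singleton (μ := P) Finset.univ (f := A)
    fun a _ => hA (measurableSet_singleton a)
  rw [Finset.coe_univ, Set.preimage_univ, probReal_univ] at this
  exact this

theorem pr_pair_eq_zero {Ω : Type*} [MeasurableSpace Ω] (P : Measure Ω) [IsFiniteMeasure P]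
    {α γ : Type*} (A : Ω → α) (Y : Ω → γ) (a : α) {b : γ} (hb : pr P Y b = 0) :
    pr P (fun ω => (A ω, Y ω)) (a, b) = 0 := by
  refine le_antisymm (hb ▸ ?_) ENNReal.toReal_nonneg
  exact measureReal_mono (μ := P) fun ω hω => (Prod.ext_iff.1 hω).2

open ProbabilityTheory in
theorem isProbabilityMeasure_cond_of_pr_ne_zero {Ω : Type*} [MeasurableSpace Ω] (P : Measure Ω)
    [IsFiniteMeasure P] {γ : Type*} {Y : Ω → γ} {b : γ} (hb : pr P Y b ≠ 0) :
    IsProbabilityMeasure (P[|Y ⁻¹' {b}]) :=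
  cond_isProbabilityMeasure fun h0 => hb <| (ENNReal.toReal_eq_zero_iff _).2 (.inl h0)

open ProbabilityTheory in
/-- Conditional entropy is the average of the entropies of the conditional distributions. -/
theorem condEnt_eq_sum_cond {Ω : Type*} [MeasurableSpace Ω] (P : Measure Ω) [IsFiniteMeasure P]
    {α γ : Type*} [Fintype α] [MeasurableSpace α] [MeasurableSingletonClass α]
    [Fintype γ] [MeasurableSpace γ] [MeasurableSingletonClass γ]
    {A : Ω → α} {Y : Ω → γ} (hA : Measurable A) (hY : Measurable Y) :
    condEnt P A Y = ∑ b, pr P Y b * ent (P[|Y ⁻¹' {b}]) A := by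
  rw [condEnt, ent, ent, Fintype.sum_prod_type_right, ← Finset.sum_sub_distrib]
  refine Finset.sum_congr rfl fun b _ => ?_
  by_cases hb : pr P Y b = 0
  · simp [hb, pr_pair_eq_zero P A Y _ hb]
  · have := isProbabilityMeasure_cond_of_pr_ne_zero P hb
    have key (a : α) : pr P (fun ω => (A ω, Y ω)) (a, b)
        = pr P Y b * pr (P[|Y ⁻¹' {b}]) A a := by
      rw [pr_cond P A hY, mul_div_cancel₀ _ hb]
    simp only [key, Real.negMulLog_mul, Finset.sum_add_distrib, ← Finset.sum_mul,
      ← Finset.mul_sum, sum_pr _ hA, ent]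
    ring

theorem negMulLog_prod {ι : Type*} [DecidableEq ι] (s : Finset ι) (p : ι → ℝ) :
    Real.negMulLog (∏ i ∈ s, p i)
      = ∑ i ∈ s, ∏ j ∈ s, if j = i then Real.negMulLog (p j) else p j := by
  induction s using Finset.induction_on with
  | empty => simp
  | insert i s hi ih =>
    rw [Finset.prod_insert hi, Real.negMulLog_mul, ih, Finset.sum_insert hi,
      Finset.prod_insert hi, if_pos rfl, Finset.mul_sum, mul_comm]
    congr 1
    · refine congrArg _ (Finset.prod_congr rfl fun j hj => ?_)
      rw [if_neg (ne_of_mem_of_not_mem hj hi)]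
    · refine Finset.sum_congr rfl fun j hj => ?_
      rw [Finset.prod_insert hi, if_neg (ne_of_mem_of_not_mem hj hi).symm]

theorem sum_negMulLog_prod {ι : Type*} [Fintype ι] {α : ι → Type*} [∀ i, Fintype (α i)]
    [Fintype (∀ i, α i)] (p : ∀ i, α i → ℝ) (hp : ∀ i, ∑ x, p i x = 1) :
    ∑ a : ∀ i, α i, Real.negMulLog (∏ i, p i (a i)) = ∑ i, ∑ x, Real.negMulLog (p i x) := by
  classical
  simp only [negMulLog_prod]
  rw [Finset.sum_comm]
  refine Finset.sum_congr rfl fun i _ => ?_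
  have := Finset.prod_univ_sum (fun i => (Finset.univ : Finset (α i)))
    fun j x => if j = i then Real.negMulLog (p j x) else p j x
  rw [Fintype.piFinset_univ] at this
  convert this.symm using 1
  · congr!
  · rw [Fintype.prod_eq_single i]
    · simp
    · intro j hj
      simp [hj, hp]

theorem ent_pi_eq_sum {Ω : Type*} [MeasurableSpace Ω] (P : Measure Ω) [IsProbabilityMeasure P]
    {ι : Type*} [Fintype ι] {α : ι → Type*} [∀ i, Fintype (α i)] [Fintype (∀ i, α i)]
    [∀ i, MeasurableSpace (α i)] [∀ i, MeasurableSingletonClass (α i)]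
    {h : ∀ i, Ω → α i} (hmeas : ∀ i, Measurable (h i))
    (hindep : ∀ a : ∀ i, α i, pr P (fun ω i => h i ω) a = ∏ i, pr P (h i) (a i)) :
    ent P (fun ω i => h i ω) = ∑ i, ent P (h i) := by
  simp only [ent, hindep]
  exact sum_negMulLog_prod _ fun i => sum_pr P (hmeas i)

open ProbabilityTheory in
theorem iIndepFun_of_pr_eq_prod {Ω : Type*} [MeasurableSpace Ω] (P : Measure Ω)
    [IsProbabilityMeasure P] {ι : Type*} [Fintype ι] {α : ι → Type*} [∀ i, Fintype (α i)]
    [∀ i, MeasurableSpace (α i)] [∀ i, MeasurableSingletonClass (α i)]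
    {h : ∀ i, Ω → α i} (hmeas : ∀ i, Measurable (h i))
    (hindep : ∀ a : ∀ i, α i, pr P (fun ω i => h i ω) a = ∏ i, pr P (h i) (a i)) :
    iIndepFun h P := by
  have (i : ι) := Measure.isProbabilityMeasure_map (μ := P) (hmeas i).aemeasurable
  rw [iIndepFun_iff_map_fun_eq_pi_map fun i => (hmeas i).aemeasurable]
  refine Measure.ext_of_singleton fun a => ?_
  rw [Measure.pi_singleton, Measure.map_apply (by fun_prop) (measurableSet_singleton a)]
  simp only [Measure.map_apply (hmeas _) (measurableSet_singleton _)]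
  rw [← ENNReal.toReal_eq_toReal_iff' (by finiteness)
    (ENNReal.prod_ne_top fun i _ => by finiteness), ENNReal.toReal_prod]
  exact hindep a

open ProbabilityTheory in
theorem mi_eq_zero_of_indepFun {Ω : Type*} [MeasurableSpace Ω] (P : Measure Ω)
    [IsProbabilityMeasure P] {α β : Type*}
    [Fintype α] [MeasurableSpace α] [MeasurableSingletonClass α]
    [Fintype β] [MeasurableSpace β] [MeasurableSingletonClass β]
    {A : Ω → α} {B : Ω → β} (hA : Measurable A) (hB : Measurable B) (hAB : IndepFun A B P) :
    mi P A B = 0 := by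
  have key (a : α) (b : β) : pr P (fun ω => (A ω, B ω)) (a, b) = pr P A a * pr P B b := by
    have := hAB.measure_inter_preimage_eq_mul {a} {b} (measurableSet_singleton a)
      (measurableSet_singleton b)
    rw [pr, pr, pr, ← ENNReal.toReal_mul]
    have hset : {ω | (A ω, B ω) = (a, b)} = A ⁻¹' {a} ∩ B ⁻¹' {b} := by
      ext ω
      simp
    rw [hset]
    exact congrArg ENNReal.toReal this
  simp only [mi, ent, Fintype.sum_prod_type, key, Real.negMulLog_mul, Finset.sum_add_distrib,
    ← Finset.sum_mul, ← Finset.mul_sum, sum_pr P hA, sum_pr P hB]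
  ring

open ProbabilityTheory in
theorem cmi_eq_sum_cond {Ω : Type*} [MeasurableSpace Ω] (P : Measure Ω) [IsFiniteMeasure P]
    {α β γ : Type*} [Fintype α] [MeasurableSpace α] [MeasurableSingletonClass α]
    [Fintype β] [MeasurableSpace β] [MeasurableSingletonClass β]
    [Fintype γ] [MeasurableSpace γ] [MeasurableSingletonClass γ]
    {A : Ω → α} {B : Ω → β} {Y : Ω → γ}
    (hA : Measurable A) (hB : Measurable B) (hY : Measurable Y) :
    cmi P A B Y = ∑ b, pr P Y b * mi (P[|Y ⁻¹' {b}]) A B := by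
  simp only [cmi, mi, condEnt_eq_sum_cond P hA hY, condEnt_eq_sum_cond P hB hY,
    condEnt_eq_sum_cond P (hA.prodMk hB) hY, mul_sub, mul_add, Finset.sum_sub_distrib,
    Finset.sum_add_distrib]

/-- under mutual independence and conditional mutual independence given `y`,
the three-property objective decomposes:
`I((h₁,…,h_k); y) − α·∑ᵢ H(hᵢ|y) − β·∑_{i≠j} I(hᵢ;hⱼ;y) = (1+α)·∑ᵢ I(hᵢ;y) − α·∑ᵢ H(hᵢ)`,
and in particular `∑_{i≠j} I(hᵢ;hⱼ;y) = 0`. -/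
theorem three_property_objective_decomposition
    {Ω : Type*} [MeasurableSpace Ω] (P : Measure Ω) [IsProbabilityMeasure P]
    {k : ℕ} {α : Fin k → Type*} [∀ i, Fintype (α i)] [∀ i, Nonempty (α i)]
    [∀ i, MeasurableSpace (α i)] [∀ i, MeasurableSingletonClass (α i)]
    {γ : Type*} [Fintype γ] [Nonempty γ] [MeasurableSpace γ] [MeasurableSingletonClass γ]
    (h : ∀ i, Ω → α i) (y : Ω → γ)
    (hmeas : ∀ i, Measurable (h i)) (hy : Measurable y)
    (α' β' : ℝ)
    (hindep : ∀ a : ∀ i, α i,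
      pr P (fun ω i => h i ω) a = ∏ i, pr P (h i) (a i))
    (hcondIndep : ∀ b : γ, 0 < pr P y b → ∀ a : ∀ i, α i,
      pr P (fun ω => ((fun i => h i ω), y ω)) (a, b) / pr P y b
        = ∏ i, (pr P (fun ω => (h i ω, y ω)) (a i, b) / pr P y b)) :
    mi P (fun ω i => h i ω) y - α' * ∑ i, condEnt P (h i) y
      - β' * ∑ i, ∑ j ∈ Finset.univ.erase i, interInfo P (h i) (h j) y
      = (1 + α') * ∑ i, mi P (h i) y - α' * ∑ i, ent P (h i) ∧
    ∑ i, ∑ j ∈ Finset.univ.erase i, interInfo P (h i) (h j) y = 0 := by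
  have hcond (b : γ) (hb : pr P y b ≠ 0) (a : ∀ i, α i) :
      pr (ProbabilityTheory.cond P (y ⁻¹' {b})) (fun ω i => h i ω) a
        = ∏ i, pr (ProbabilityTheory.cond P (y ⁻¹' {b})) (h i) (a i) := by
    simp only [pr_cond P _ hy]
    exact hcondIndep b (ENNReal.toReal_nonneg.lt_of_ne' hb) a
  have hcondEnt : condEnt P (fun ω i => h i ω) y = ∑ i, condEnt P (h i) y := by
    simp only [condEnt_eq_sum_cond P (measurable_pi_lambda _ hmeas) hy,
      condEnt_eq_sum_cond P (hmeas _) hy]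
    rw [Finset.sum_comm]
    refine Finset.sum_congr rfl fun b _ => ?_
    by_cases hb : pr P y b = 0
    · simp [hb]
    · have := isProbabilityMeasure_cond_of_pr_ne_zero P hb
      rw [ent_pi_eq_sum _ hmeas (hcond b hb), Finset.mul_sum]
  have hinter : ∑ i, ∑ j ∈ Finset.univ.erase i, interInfo P (h i) (h j) y = 0 := by
    refine Finset.sum_eq_zero fun i _ => Finset.sum_eq_zero fun j hj => ?_
    have hij : i ≠ j := (Finset.ne_of_mem_erase hj).symm
    rw [interInfo, cmi_eq_sum_cond P (hmeas i) (hmeas j) hy, mi_eq_zero_of_indepFun P (hmeas i)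
      (hmeas j) ((iIndepFun_of_pr_eq_prod P hmeas hindep).indepFun hij), zero_sub, neg_eq_zero]
    refine Finset.sum_eq_zero fun b _ => ?_
    by_cases hb : pr P y b = 0
    · rw [hb, zero_mul]
    · have := isProbabilityMeasure_cond_of_pr_ne_zero P hb
      rw [mi_eq_zero_of_indepFun _ (hmeas i) (hmeas j)
        ((iIndepFun_of_pr_eq_prod _ hmeas (hcond b hb)).indepFun hij), mul_zero]
  have hmi : mi P (fun ω i => h i ω) y
      = ent P (fun ω i => h i ω) - condEnt P (fun ω i => h i ω) y := by
    rw [mi, condEnt]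
    ring
  refine ⟨?_, hinter⟩
  rw [hinter, hmi, hcondEnt, ent_pi_eq_sum P hmeas hindep]
  simp only [mi, condEnt, Finset.sum_sub_distrib, Finset.sum_add_distrib]
  ring
end

section
/- Let m ≥ 1, let q be a subset of {0,…,m−1} with cardinality k ≥ 2, let φ : ℝ → ℝ, and define F : (Fin m → ℝ) → ℝ by F(x) = φ( Σ_{i∈q} x_i ). Suppose there exist a base point s ∈ ℝ and increments h : q → ℝ such that the k-th iterated finite difference Σ_{S ⊆ q} (−1)^{k−|S|} φ( s + Σ_{j∈S} h_j ) is nonzero. Then q is a statistical interaction of F: there is no family of functions f_{\i} : (Fin m → ℝ) → ℝ indexed by i ∈ q, each f_{\i} not depending on coordinate i, with F(x) = Σ_{i∈q} f_{\i}(x) for all x. -/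
open Finset

/-- An alternating sum over the subsets of `q` vanishes if the summand ignores whether a fixed
`i ∈ q` belongs to the subset. -/
theorem sum_powerset_neg_one_pow_mul_eq_zero {ι R : Type*} [DecidableEq ι] [CommRing R]
    {q : Finset ι} {i : ι} (hi : i ∈ q) (g : Finset ι → R)
    (hg : ∀ S ⊆ q.erase i, g (insert i S) = g S) :
    ∑ S ∈ q.powerset, (-1 : R) ^ (q.card - S.card) * g S = 0 := by
  have hni : i ∉ q.erase i := notMem_erase i q
  have hcard : q.card = (q.erase i).card + 1 := (card_erase_add_one hi).symm
  rw [hcard]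
  nth_rewrite 1 [← insert_erase hi]
  rw [sum_powerset_insert hni, ← sum_add_distrib]
  refine sum_eq_zero fun S hS => ?_
  rw [mem_powerset] at hS
  have hle : S.card ≤ (q.erase i).card := card_le_card hS
  rw [hg S hS, card_insert_of_notMem (fun h => hni (hS h)), Nat.add_sub_add_right,
    Nat.sub_add_comm hle, pow_succ]
  ring

/-- if some `k`-th iterated finite difference of `φ` is nonzero, then
`q` is a statistical interaction of `F(x) = φ(∑_{i∈q} x_i)`: there is no family of
functions `f i` (each not depending on coordinate `i`) with `F = ∑_{i∈q} f i`. -/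
theorem statistical_interaction_of_nonvanishing_difference
    {m : ℕ} (hm : 1 ≤ m) (q : Finset (Fin m)) (hk : 2 ≤ q.card)
    (φ : ℝ → ℝ) (F : (Fin m → ℝ) → ℝ)
    (hF : ∀ x : Fin m → ℝ, F x = φ (∑ i ∈ q, x i))
    (hnz : ∃ (s : ℝ) (h : Fin m → ℝ),
      ∑ S ∈ q.powerset, (-1 : ℝ) ^ (q.card - S.card) * φ (s + ∑ j ∈ S, h j) ≠ 0) :
    ¬ ∃ f : Fin m → (Fin m → ℝ) → ℝ,
      (∀ i ∈ q, ∀ x x' : Fin m → ℝ, (∀ j, j ≠ i → x j = x' j) → f i x = f i x') ∧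
      ∀ x : Fin m → ℝ, F x = ∑ i ∈ q, f i x := by
  rintro ⟨f, hf, hsum⟩
  obtain ⟨s, h, hne⟩ := hnz
  apply hne
  obtain ⟨i₀, hi₀⟩ : q.Nonempty := card_pos.mp (by omega)
  let x : Finset (Fin m) → Fin m → ℝ := fun S j =>
    (if j = i₀ then s else 0) + if j ∈ S then h j else 0
  have hx : ∀ S ∈ q.powerset, φ (s + ∑ j ∈ S, h j) = ∑ i ∈ q, f i (x S) := by
    intro S hS
    rw [← hsum, hF, sum_add_distrib, sum_ite_eq' q i₀, if_pos hi₀, sum_ite_mem,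
      inter_eq_right.mpr (mem_powerset.mp hS)]
  rw [sum_congr rfl fun S hS => by rw [hx S hS, mul_sum], sum_comm]
  refine sum_eq_zero fun i hi =>
    sum_powerset_neg_one_pow_mul_eq_zero hi (fun S => f i (x S)) fun S _ => ?_
  refine hf i hi _ _ fun j hj => ?_
  simp [x, hj]
end
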